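/- arXiv:2309.14644 — 2 statements merged into one kernel-verified Lean document; each statement's English description precedes it below -/
import Mathlib

section
/- Let s(n) be the number of standardized sock sequences of length n that are 1-stack-sortable under φ_{aba}. Let x₀ = (1 − √(8√2 − 11))/2, the smallest positive root of 1 − 6x + 7x² − 2x³ + x⁴ = 0, and let c = 1/x₀ (c = 4.5464…). Then there exist real constants K > 0 and C > 0 such that for all n ≥ 1, |s(n) − K·cⁿ·n^{−3/2}| ≤ C·cⁿ·n^{−5/2}; that is, s(n) = K·cⁿ·n^{−3/2} + O(cⁿ·n^{−5/2}). -/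
attribute [local instance] Classical.propDecidable

/-- Two lists have the same shape: same length and identical equality pattern
of entries (`q_i = q_j` iff `r_i = r_j`). -/
def SameShape {A : Type*} {B : Type*} (q : List A) (r : List B) : Prop :=
  q.length = r.length ∧ ∀ i j : ℕ, (q[i]? = q[j]? ↔ r[i]? = r[j]?)

/-- `ContainsPat p σ` : the sock sequence `p` contains the pattern `σ`
(not necessarily consecutively): there are indices `i_1 < ⋯ < i_m` such that
`p_{i_j} = p_{i_k} ↔ σ_j = σ_k`. -/
def ContainsPat {A : Type*} {B : Type*} (p : List A) (σ : List B) : Prop :=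
  ∃ q : List A, q.Sublist p ∧ SameShape q σ

/-- A sock sequence is sorted if all occurrences of each sock appear
consecutively. -/
def SortedSocks {A : Type*} (p : List A) : Prop :=
  ∀ i j k : ℕ, i ≤ j → j ≤ k → p[i]? = p[k]? → p[j]? = p[i]?

/-- One pass of the deterministic σ-avoiding stack-sorting procedure:
`sortAux σ input stack` runs the σ-avoiding stack with the given remaining
input and current stack (stack listed from top to bottom), returning the rest
of the output.  If input remains and pushing the next input sock onto the
stack does not create a σ-pattern in the stack, that sock is pushed; otherwise
the top sock of the stack is popped to the output. -/
noncomputable def sortAux {A : Type*} {B : Type*} (σ : List B) : List A → List A → List A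
  | [], stack => stack
  | x :: input, stack =>
    if ContainsPat (x :: stack) σ then
      match stack with
      | [] => sortAux σ input [x]
      | t :: rest => t :: sortAux σ (x :: input) rest
    else
      sortAux σ input (x :: stack)
termination_by input stack => 2 * input.length + stack.length
decreasing_by all_goals simp only [List.length_cons]; omega

/-- The deterministic σ-avoiding stack-sorting map `φ_σ`. -/
noncomputable def phi {A : Type*} {B : Type*} (σ : List B) (p : List A) : List A :=
  sortAux σ p []

/-- The pattern `aba`: first and third socks equal, distinct from the second. -/
def abaPat : List ℕ := [0, 1, 0]

/-- A sock sequence over `ℕ` is standardized if its first entry is `0` and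
each subsequent entry is at most one more than the maximum of all preceding
entries. -/
def Standardized (p : List ℕ) : Prop :=
  ∀ i : Fin p.length, p.get i ≤ (p.take i).foldr (fun a b => max (a + 1) b) 0

/-- `sCount n` is the number of standardized sock sequences of length `n`
that are `1`-stack-sortable under `φ_{aba}`. -/
noncomputable def sCount (n : ℕ) : ℕ :=
  Set.ncard {p : List ℕ | p.length = n ∧ Standardized p ∧
    SortedSocks (phi abaPat p)}

/-- A list is free of the sock pattern `aba`. -/
def AbaFree (l : List ℕ) : Prop :=
  ∀ a b : ℕ, [a, b, a].Sublist l → b = a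

/-- Two lists have the same sublists without equal neighbours; this holds in particular when they
agree up to repetition of neighbouring entries. -/
def SimList (l m : List ℕ) : Prop :=
  ∀ s : List ℕ, s.IsChain (· ≠ ·) → (s.Sublist l ↔ s.Sublist m)

/-- The list `st` arises from the duplicate-free list `ds` by repeating entries in place. -/
inductive Expands : List ℕ → List ℕ → Prop
  | nil : Expands [] []
  | push {x : ℕ} {st ds : List ℕ} : Expands st ds → x ∉ ds → Expands (x :: st) (x :: ds)
  | dup {x : ℕ} {st ds : List ℕ} : Expands st (x :: ds) → Expands (x :: st) (x :: ds)

/-- The output of the `aba`-avoiding stack, where the stack records each sock only once. -/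
noncomputable def runStack : List ℕ → List ℕ → List ℕ
  | [], ds => ds
  | x :: p, ds =>
    if x ∈ ds then ds.takeWhile (fun y => decide (y ≠ x)) ++
      runStack p (ds.dropWhile (fun y => decide (y ≠ x)))
    else runStack p (x :: ds)

theorem sortedSocks_iff_abaFree (l : List ℕ) : SortedSocks l ↔ AbaFree l := by
  constructor
  · intro h a b hs
    obtain ⟨f, hf⟩ := List.sublist_iff_exists_orderEmbedding_getElem?_eq.1 hs
    have h0 := hf 0
    have h1 := hf 1
    have h2 := hf 2
    simp only [List.getElem?_cons_zero, List.getElem?_cons_succ] at h0 h1 h2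
    have := h (f 0) (f 1) (f 2) (f.monotone (by omega)) (f.monotone (by omega))
      (by rw [← h0, ← h2])
    rw [← h0, ← h1] at this
    simpa using this
  · intro h i j k hij hjk hik
    by_cases hk : k < l.length
    · rcases eq_or_lt_of_le hij with rfl | hij
      · rfl
      rcases eq_or_lt_of_le hjk with rfl | hjk
      · exact hik.symm
      have hi : i < l.length := by omega
      have hj : j < l.length := by omega
      rw [List.getElem?_eq_getElem hi, List.getElem?_eq_getElem hk] at hik
      have hik' : l[i] = l[k] := by simpa using hik
      have hs : [l[i], l[j], l[k]].Sublist l := by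
        have := List.map_getElem_sublist (l := l) (is := [⟨i, hi⟩, ⟨j, hj⟩, ⟨k, hk⟩])
          (by simp [hij, hjk, hij.trans hjk])
        simpa using this
      rw [← hik'] at hs
      rw [List.getElem?_eq_getElem hi, List.getElem?_eq_getElem hj, h _ _ hs]
    · have hk' : l[k]? = none := List.getElem?_eq_none (by omega)
      rw [hk'] at hik
      have := List.getElem?_eq_none_iff.1 hik
      rw [hik, List.getElem?_eq_none (by omega)]

theorem containsPat_abaPat_iff (l : List ℕ) :
    ContainsPat l abaPat ↔ ∃ a b : ℕ, b ≠ a ∧ [a, b, a].Sublist l := by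
  constructor
  · rintro ⟨q, hq, hlen, heq⟩
    match q, hlen with
    | [a, b, c], _ =>
      have h1 := heq 0 2
      have h2 := heq 0 1
      simp [abaPat] at h1 h2
      subst h1
      exact ⟨a, b, fun h => h2 h.symm, hq⟩
  · rintro ⟨a, b, hab, hs⟩
    refine ⟨_, hs, rfl, fun i j => ?_⟩
    rcases i with _ | _ | _ | i <;> rcases j with _ | _ | _ | j <;> simp [abaPat, hab, hab.symm]

theorem SimList.refl (l : List ℕ) : SimList l l := fun _ _ => Iff.rfl

theorem SimList.trans {l l' l'' : List ℕ} (h : SimList l l') (h' : SimList l' l'') :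
    SimList l l'' := fun s hs => (h s hs).trans (h' s hs)

theorem SimList.cons {l l' : List ℕ} (a : ℕ) (h : SimList l l') :
    SimList (a :: l) (a :: l') := by
  intro s hs
  rw [List.sublist_cons_iff, List.sublist_cons_iff, h s hs]
  refine or_congr Iff.rfl (exists_congr fun r => and_congr_right ?_)
  rintro rfl
  exact h r (by simpa using hs.tail)

theorem SimList.dup (a : ℕ) (l : List ℕ) : SimList (a :: a :: l) (a :: l) := by
  intro s hs
  refine ⟨fun h => ?_, fun h => h.cons _⟩
  rcases List.sublist_cons_iff.1 h with h | ⟨r, rfl, hr⟩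
  · exact h
  rcases List.sublist_cons_iff.1 hr with hr | ⟨r', rfl, -⟩
  · exact hr.cons_cons a
  · simp at hs

theorem SimList.abaFree_iff {l l' : List ℕ} (h : SimList l l') : AbaFree l ↔ AbaFree l' := by
  refine forall_congr' fun a => forall_congr' fun b => ?_
  by_cases hab : b = a
  · simp [hab]
  · rw [h [a, b, a] (by simp [hab, Ne.symm hab])]

theorem Expands.simList {st ds : List ℕ} (h : Expands st ds) : SimList st ds := by
  induction h with
  | nil => exact SimList.refl _
  | push _ _ ih => exact ih.cons _
  | dup _ ih => exact (ih.cons _).trans (SimList.dup _ _)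

theorem Expands.nodup {st ds : List ℕ} (h : Expands st ds) : ds.Nodup := by
  induction h with
  | nil => exact List.nodup_nil
  | push _ hx ih => exact List.nodup_cons.2 ⟨hx, ih⟩
  | dup _ ih => exact ih

theorem abaFree_of_nodup {l : List ℕ} (h : l.Nodup) : AbaFree l := by
  intro a b hs
  have := h.sublist hs
  simp at this

theorem Expands.containsPat_cons_iff {st ds : List ℕ} (h : Expands st ds) (x : ℕ) :
    ContainsPat (x :: st) abaPat ↔ x ∈ ds ∧ ds.head? ≠ some x := by
  rw [containsPat_abaPat_iff]
  have hnd := h.nodup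
  constructor
  · rintro ⟨a, b, hab, hs⟩
    have hs' := ((h.simList.cons x) [a, b, a] (by simp [hab, hab.symm])).1 hs
    rcases List.sublist_cons_iff.1 hs' with hs' | ⟨r, hr, hs'⟩
    · exact absurd (abaFree_of_nodup hnd a b hs') hab
    · simp only [List.cons.injEq] at hr
      obtain ⟨rfl, rfl⟩ := hr
      refine ⟨hs'.subset (by simp), ?_⟩
      cases ds with
      | nil => simp
      | cons d ds =>
        simp only [List.head?_cons, ne_eq, Option.some.injEq]
        rintro rfl
        rcases List.sublist_cons_iff.1 hs' with hs' | ⟨r, hr, hs'⟩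
        · exact (List.nodup_cons.1 hnd).1 (hs'.subset (by simp))
        · simp at hr
          exact hab hr.1
  · rintro ⟨hx, hh⟩
    cases ds with
    | nil => simp at hx
    | cons d ds =>
      simp only [List.head?_cons, ne_eq, Option.some.injEq] at hh
      have hx' : x ∈ ds := by
        rcases List.mem_cons.1 hx with rfl | h
        · exact absurd rfl hh
        · exact h
      refine ⟨x, d, hh, ((h.simList.cons x) [x, d, x] (by simp [hh, Ne.symm hh])).2 ?_⟩
      exact ((List.singleton_sublist.2 hx').cons_cons d).cons_cons x

theorem runStack_cons_of_ne {x d : ℕ} {p ds : List ℕ} (hx : x ∈ ds) (hd : d ≠ x) :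
    runStack (x :: p) (d :: ds) = d :: runStack (x :: p) ds := by
  simp [runStack, hx, hd]

theorem Expands.simList_sortAux {st ds : List ℕ} (h : Expands st ds) (p : List ℕ) :
    SimList (sortAux abaPat p st) (runStack p ds) := by
  induction p generalizing st ds with
  | nil =>
    rw [sortAux, runStack]
    exact h.simList
  | cons x p ih =>
    induction h with
    | nil =>
      have hc : ¬ ContainsPat [x] abaPat := by
        rw [Expands.nil.containsPat_cons_iff]; simp
      rw [sortAux, if_neg hc]
      simpa [runStack] using ih (Expands.push Expands.nil (by simp))
    | @push d st ds h hd ih' =>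
      have hE := h.push hd
      by_cases hc : ContainsPat (x :: d :: st) abaPat
      · rw [sortAux, if_pos hc]
        rw [hE.containsPat_cons_iff] at hc
        have hdx : d ≠ x := by simpa using hc.2
        have hx : x ∈ ds := by simpa [hdx.symm] using hc.1
        rw [runStack_cons_of_ne hx hdx]
        exact ih'.cons d
      · rw [sortAux, if_neg hc]
        rw [hE.containsPat_cons_iff] at hc
        by_cases hdx : d = x
        · subst hdx
          simpa [runStack] using ih hE.dup
        · have hx : x ∉ d :: ds := fun hx => hc ⟨hx, by simpa using hdx⟩
          rw [runStack, if_neg hx]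
          exact ih (hE.push hx)
    | @dup d st ds h ih' =>
      have hE := h.dup
      by_cases hc : ContainsPat (x :: d :: st) abaPat
      · rw [sortAux, if_pos hc]
        rw [hE.containsPat_cons_iff] at hc
        have hdx : d ≠ x := by simpa using hc.2
        have hx : x ∈ ds := by simpa [hdx.symm] using hc.1
        refine (ih'.cons d).trans ?_
        rw [runStack_cons_of_ne hx hdx]
        exact SimList.dup _ _
      · rw [sortAux, if_neg hc]
        rw [hE.containsPat_cons_iff] at hc
        by_cases hdx : d = x
        · subst hdx
          simpa [runStack] using ih hE.dup
        · have hx : x ∉ d :: ds := fun hx => hc ⟨hx, by simpa using hdx⟩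
          rw [runStack, if_neg hx]
          exact ih (hE.push hx)

theorem sortedSocks_phi_iff (p : List ℕ) :
    SortedSocks (phi abaPat p) ↔ AbaFree (runStack p []) := by
  rw [sortedSocks_iff_abaFree]
  exact (Expands.nil.simList_sortAux p).abaFree_iff

/-- The lists of length `n` whose entries exceed by at most one the maximum of the entries seen so
far, where `0, …, m - 1` count as seen. -/
noncomputable def restrictedWords : ℕ → ℕ → Finset (List ℕ)
  | _, 0 => {[]}
  | m, n + 1 => (Finset.range (m + 1)).biUnion fun x =>
      (restrictedWords (max m (x + 1)) n).image (List.cons x)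

theorem foldr_max_succ (l : List ℕ) (x m : ℕ) :
    l.foldr (fun a b => max (a + 1) b) (max m (x + 1)) =
      max (x + 1) (l.foldr (fun a b => max (a + 1) b) m) := by
  induction l with
  | nil => simp [max_comm]
  | cons a l ih => simp only [List.foldr_cons, ih]; omega

theorem mem_restrictedWords {m n : ℕ} {p : List ℕ} :
    p ∈ restrictedWords m n ↔ p.length = n ∧
      ∀ i : Fin p.length, p.get i ≤ (p.take i).foldr (fun a b => max (a + 1) b) m := by
  induction n generalizing m p with
  | zero =>
    simp only [restrictedWords, Finset.mem_singleton, List.length_eq_zero_iff]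
    constructor
    · rintro rfl
      exact ⟨rfl, fun i => i.elim0⟩
    · exact fun h => h.1
  | succ n ih =>
    simp only [restrictedWords, Finset.mem_biUnion, Finset.mem_range, Finset.mem_image, ih]
    constructor
    · rintro ⟨x, hx, q, ⟨hq, hq'⟩, rfl⟩
      refine ⟨by simp [hq], fun i => ?_⟩
      induction i using Fin.cases with
      | zero => simpa using Nat.lt_succ_iff.1 hx
      | succ i =>
        have := hq' i
        rw [foldr_max_succ] at this
        simpa using this
    · cases p with
      | nil => simp
      | cons x q =>
        rintro ⟨hq, hq'⟩
        refine ⟨x, ?_, q, ⟨by simpa using hq, fun i => ?_⟩, rfl⟩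
        · simpa [Nat.lt_succ_iff] using hq' ⟨0, by simp⟩
        · rw [foldr_max_succ]
          simpa using hq' i.succ

theorem card_filter_restrictedWords_succ (m n : ℕ) (P : List ℕ → Prop) :
    ((restrictedWords m (n + 1)).filter P).card =
      ∑ x ∈ Finset.range (m + 1),
        ((restrictedWords (max m (x + 1)) n).filter fun p => P (x :: p)).card := by
  rw [restrictedWords, Finset.filter_biUnion, Finset.card_biUnion]
  · refine Finset.sum_congr rfl fun x _ => ?_
    rw [Finset.filter_image, Finset.card_image_of_injective _ (List.cons_injective)]
  · intro x _ y _ hxy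
    rw [Function.onFun, Finset.disjoint_left]
    simp only [Finset.mem_filter, Finset.mem_image, not_and, and_imp]
    rintro _ ⟨p, _, rfl⟩ _ ⟨q, _, h⟩
    simp only [List.cons.injEq] at h
    exact absurd h.1.symm hxy

/-- The number of continuations of length `n` with `aba`-free output, when the socks `0, …, m - 1`
have been seen, `out` has been output and `ds` is on the stack. -/
noncomputable def goodCount (out ds : List ℕ) (m n : ℕ) : ℕ :=
  ((restrictedWords m n).filter fun p => AbaFree (out ++ runStack p ds)).card

theorem sCount_eq_goodCount (n : ℕ) : sCount n = goodCount [] [] 0 n := by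
  rw [sCount, goodCount, ← Set.ncard_coe_finset]
  congr 1
  ext p
  simp only [Set.mem_ofPred_eq, Finset.coe_filter, mem_restrictedWords, sortedSocks_phi_iff,
    Standardized, List.nil_append, and_assoc]

theorem goodCount_zero (out ds : List ℕ) (m : ℕ) (h : AbaFree (out ++ ds)) :
    goodCount out ds m 0 = 1 := by
  simp [goodCount, restrictedWords, runStack, Finset.filter_singleton, h]

theorem goodCount_succ (out ds : List ℕ) (m n : ℕ) :
    goodCount out ds m (n + 1) = ∑ x ∈ Finset.range (m + 1),
      if x ∈ ds then goodCount (out ++ ds.takeWhile (fun y => decide (y ≠ x)))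
        (ds.dropWhile (fun y => decide (y ≠ x))) (max m (x + 1)) n
      else goodCount out (x :: ds) (max m (x + 1)) n := by
  rw [goodCount, card_filter_restrictedWords_succ]
  refine Finset.sum_congr rfl fun x _ => ?_
  split_ifs with h <;> simp [goodCount, runStack, h]

theorem sublist_runStack (p ds : List ℕ) : ds.Sublist (runStack p ds) := by
  induction p generalizing ds with
  | nil => simp [runStack]
  | cons x p ih =>
    rw [runStack]
    split_ifs with h
    · conv_lhs => rw [← List.takeWhile_append_dropWhile (p := fun y => decide (y ≠ x)) (l := ds)]
      exact (List.Sublist.refl _).append (ih _)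
    · exact (List.sublist_cons_self _ _).trans (ih _)

theorem AbaFree.sublist {l l' : List ℕ} (h : AbaFree l') (hs : l.Sublist l') : AbaFree l :=
  fun a b hab => h a b (hab.trans hs)

theorem goodCount_eq_zero {out ds : List ℕ} (m n : ℕ) (h : ¬ AbaFree (out ++ ds)) :
    goodCount out ds m n = 0 := by
  rw [goodCount, Finset.card_eq_zero, Finset.filter_eq_empty_iff]
  exact fun p _ hp => h (hp.sublist ((List.Sublist.refl _).append (sublist_runStack p ds)))

theorem SimList.append_left {l l' : List ℕ} (u : List ℕ) (h : SimList l l') :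
    SimList (u ++ l) (u ++ l') := by
  induction u with
  | nil => exact h
  | cons a u ih => exact ih.cons a

theorem AbaFree.append {l l' : List ℕ} (h : AbaFree l) (h' : l'.Nodup) (hd : ∀ x ∈ l', x ∉ l) :
    AbaFree (l ++ l') := by
  intro a b hs
  obtain ⟨u, v, huv, hu, hv⟩ := List.sublist_append_iff.1 hs
  match u, huv with
  | [], huv =>
    obtain rfl : [a, b, a] = v := by simpa using huv
    exact abaFree_of_nodup h' a b hv
  | [c], huv =>
    simp only [List.cons_append, List.nil_append, List.cons.injEq] at huv
    obtain ⟨rfl, rfl⟩ := huv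
    exact absurd (hu.subset (by simp)) (hd a (hv.subset (by simp)))
  | [c, d], huv =>
    simp only [List.cons_append, List.nil_append, List.cons.injEq] at huv
    obtain ⟨rfl, rfl, rfl⟩ := huv
    exact absurd (hu.subset (by simp)) (hd a (hv.subset (by simp)))
  | c :: d :: e :: w, huv =>
    simp only [List.cons_append, List.cons.injEq] at huv
    obtain ⟨rfl, rfl, rfl, hw⟩ := huv
    obtain rfl : w = [] := by
      cases w with
      | nil => rfl
      | cons _ _ => simp at hw
    exact h _ _ hu

theorem not_abaFree_append_cons {o ds : List ℕ} {l x : ℕ} (hx : x ∈ o ++ [l]) (hxl : x ≠ l) :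
    ¬ AbaFree ((o ++ [l]) ++ x :: ds) := by
  intro h
  have hxo : x ∈ o := by simpa [hxl] using hx
  refine hxl (h x l ?_).symm
  have h1 : ([x] ++ [l]).Sublist (o ++ [l]) :=
    (List.singleton_sublist.2 hxo).append (List.Sublist.refl _)
  exact h1.append ((List.nil_sublist ds).cons_cons x)

theorem sum_map_length_dropWhile {M : Type*} [AddCommMonoid M] (f : ℕ → M) {ds : List ℕ}
    (h : ds.Nodup) :
    (ds.map fun x => f (ds.dropWhile fun y => decide (y ≠ x)).length).sum =
      ∑ j ∈ Finset.range ds.length, f (j + 1) := by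
  induction ds with
  | nil => simp
  | cons a l ih =>
    obtain ⟨ha, hl⟩ := List.nodup_cons.1 h
    rw [List.length_cons, Finset.sum_range_succ, ← ih hl, List.map_cons, List.sum_cons, add_comm]
    congr 2
    · refine List.map_congr_left fun x hx => ?_
      have : a ≠ x := fun hax => ha (hax ▸ hx)
      simp [this]
    · simp

theorem goodCount_succ_cons (out : List ℕ) {a : ℕ} {ds : List ℕ} (m n : ℕ)
    (hnd : (a :: ds).Nodup) (hm : ∀ x ∈ a :: ds, x < m) :
    goodCount out (a :: ds) m (n + 1) = goodCount out (a :: ds) m n +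
      (ds.map fun x => goodCount (out ++ a :: ds.takeWhile fun y => decide (y ≠ x))
        (ds.dropWhile fun y => decide (y ≠ x)) m n).sum +
      goodCount out (m :: a :: ds) (m + 1) n +
      ∑ x ∈ Finset.range m \ (a :: ds).toFinset, goodCount out (x :: a :: ds) m n := by
  have hmax : ∀ x, x < m → max m (x + 1) = m := fun x hx => by omega
  have hsub : (a :: ds).toFinset ⊆ Finset.range m := fun x hx => by
    simpa using hm x (by simpa using hx)
  have hmm : m ∉ a :: ds := fun h => lt_irrefl _ (hm m h)
  rw [goodCount_succ, Finset.sum_range_succ, if_neg hmm, ← Finset.sum_sdiff hsub,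
    List.sum_toFinset _ hnd, List.map_cons, List.sum_cons, if_pos (by simp),
    hmax a (hm a (by simp))]
  have h1 : ∀ x ∈ ds, (if x ∈ a :: ds then
        goodCount (out ++ (a :: ds).takeWhile (fun y => decide (y ≠ x)))
          ((a :: ds).dropWhile (fun y => decide (y ≠ x))) (max m (x + 1)) n
      else goodCount out (x :: a :: ds) (max m (x + 1)) n) =
      goodCount (out ++ a :: ds.takeWhile fun y => decide (y ≠ x))
        (ds.dropWhile fun y => decide (y ≠ x)) m n := by
    intro x hx
    have hax : a ≠ x := fun h => (List.nodup_cons.1 hnd).1 (h ▸ hx)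
    rw [if_pos (List.mem_cons_of_mem _ hx), hmax x (hm x (List.mem_cons_of_mem _ hx))]
    simp [hax]
  have h2 : ∀ x ∈ Finset.range m \ (a :: ds).toFinset, (if x ∈ a :: ds then
        goodCount (out ++ (a :: ds).takeWhile (fun y => decide (y ≠ x)))
          ((a :: ds).dropWhile (fun y => decide (y ≠ x))) (max m (x + 1)) n
      else goodCount out (x :: a :: ds) (max m (x + 1)) n) =
      goodCount out (x :: a :: ds) m n := by
    intro x hx
    rw [Finset.mem_sdiff, Finset.mem_range, List.mem_toFinset] at hx
    rw [if_neg hx.2, hmax x hx.1]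
  rw [List.map_congr_left h1, Finset.sum_congr rfl h2]
  simp
  ring

/-- The stack `ds` is nonempty and disjoint from the nonempty output `out`, which is `aba`-free;
together they consist of the socks `0, …, m - 1`. -/
structure Settled (out ds : List ℕ) (m : ℕ) : Prop where
  out_ne_nil : out ≠ []
  abaFree : AbaFree out
  ds_ne_nil : ds ≠ []
  nodup : ds.Nodup
  disjoint : ∀ x ∈ ds, x ∉ out
  lt_iff : ∀ x, x < m ↔ x ∈ out ∨ x ∈ ds

theorem Settled.abaFree_append {out ds : List ℕ} {m : ℕ} (h : Settled out ds m) :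
    AbaFree (out ++ ds) := h.abaFree.append h.nodup h.disjoint

theorem Settled.abaFree_append_getLast {o ds : List ℕ} {l m : ℕ} (h : Settled (o ++ [l]) ds m) :
    AbaFree ((o ++ [l]) ++ l :: ds) := by
  have h1 : SimList (o ++ l :: l :: ds) (o ++ l :: ds) := (SimList.dup l ds).append_left o
  have h2 := h.abaFree_append
  simp only [List.append_assoc, List.cons_append, List.nil_append] at h2 ⊢
  exact h1.abaFree_iff.2 h2

theorem Settled.push {out ds : List ℕ} {m : ℕ} (h : Settled out ds m) :
    Settled out (m :: ds) (m + 1) := by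
  have hm : ¬ (m ∈ out ∨ m ∈ ds) := fun hm => lt_irrefl _ ((h.lt_iff m).2 hm)
  rw [not_or] at hm
  refine ⟨h.out_ne_nil, h.abaFree, by simp, List.nodup_cons.2 ⟨hm.2, h.nodup⟩, ?_, fun x => ?_⟩
  · intro x hx
    rcases List.mem_cons.1 hx with rfl | hx
    · exact hm.1
    · exact h.disjoint x hx
  · rw [Nat.lt_succ_iff_lt_or_eq, h.lt_iff, List.mem_cons]
    tauto

theorem settled_pop {out ds : List ℕ} {a m x : ℕ} (hfree : AbaFree (out ++ a :: ds))
    (hnd : (a :: ds).Nodup) (hdisj : ∀ y ∈ ds, y ∉ out)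
    (hm : ∀ y, y < m ↔ y ∈ out ∨ y ∈ a :: ds) (hx : x ∈ ds) :
    Settled (out ++ a :: ds.takeWhile fun y => decide (y ≠ x))
      (ds.dropWhile fun y => decide (y ≠ x)) m := by
  set u := ds.takeWhile fun y => decide (y ≠ x) with hu
  set v := ds.dropWhile fun y => decide (y ≠ x) with hv
  have huv : ds = u ++ v := List.takeWhile_append_dropWhile.symm
  have hvne : v ≠ [] := by
    rw [hv, ne_eq, List.dropWhile_eq_nil_iff]
    intro h
    simpa using h x hx
  rw [huv] at hfree hnd hdisj hm
  rw [List.nodup_cons, List.nodup_append'] at hnd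
  refine ⟨by simp, hfree.sublist ?_, hvne, hnd.2.2.1, fun y hy => ?_, fun y => ?_⟩
  · simp
  · have h1 := hdisj y (by simp [hy])
    have h2 : y ≠ a := fun h => hnd.1 (by simp [← h, hy])
    have h3 : y ∉ u := fun h => hnd.2.2.2 h hy
    simp [h1, h2, h3]
  · rw [hm]
    simp only [List.mem_append, List.mem_cons]
    tauto

section GeneratingFunction

open PowerSeries

/-- The equations satisfied by the generating function `r`, written in the variable `y * X`, where
`g` is the geometric series of `y * X`. -/
structure StackSeries (y : ℂ) (g r : PowerSeries ℂ) : Prop where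
  geo : g = 1 + C y * X * g
  eq : r = 1 + C y * X * r ^ 2 + (C y * X) ^ 2 * g * r

variable {y : ℂ} {g r : PowerSeries ℂ}

theorem StackSeries.sum_pow (h : StackSeries y g r) (k : ℕ) :
    C y * X * ∑ j ∈ Finset.range k, r ^ (j + 1) * (r + C y * X * g) = r ^ k - 1 := by
  induction k with
  | zero => simp
  | succ k ih =>
    rw [Finset.sum_range_succ, mul_add, ih]
    linear_combination -r ^ k * h.eq

theorem coeff_succ_C_mul_X_mul (n : ℕ) (f : PowerSeries ℂ) :
    coeff (n + 1) (C y * X * f) = y * coeff n f := by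
  rw [mul_assoc, coeff_C_mul, coeff_succ_X_mul]

theorem coeff_succ_sub_one (n : ℕ) (f : PowerSeries ℂ) :
    coeff (n + 1) (f - 1) = coeff (n + 1) f := by
  simp [coeff_one]

theorem StackSeries.constantCoeff_geo (h : StackSeries y g r) : constantCoeff g = 1 := by
  rw [h.geo]; simp

theorem StackSeries.constantCoeff_eq (h : StackSeries y g r) : constantCoeff r = 1 := by
  rw [h.eq]; simp

theorem sum_goodCount_pop {n : ℕ} {f : ℕ → PowerSeries ℂ}
    (ih : ∀ out ds m, Settled out ds m → (goodCount out ds m n : ℂ) * y ^ n =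
      coeff n (f ds.length))
    {out ds : List ℕ} {a m : ℕ} (hfree : AbaFree (out ++ a :: ds))
    (hnd : (a :: ds).Nodup) (hdisj : ∀ y ∈ ds, y ∉ out)
    (hm : ∀ y, y < m ↔ y ∈ out ∨ y ∈ a :: ds) :
    ((ds.map fun x => goodCount (out ++ a :: ds.takeWhile fun y => decide (y ≠ x))
        (ds.dropWhile fun y => decide (y ≠ x)) m n).sum : ℂ) * y ^ n =
      coeff n (∑ j ∈ Finset.range ds.length, f (j + 1)) := by
  rw [← sum_map_length_dropWhile f (List.nodup_cons.1 hnd).2, Nat.cast_list_sum,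
    ← List.sum_map_mul_right, map_list_sum, List.map_map, List.map_map]
  congr 1
  exact List.map_congr_left fun x hx => ih _ _ _ (settled_pop hfree hnd hdisj hm hx)

theorem goodCount_settled (h : StackSeries y g r) (n : ℕ) :
    (∀ out ds m, Settled out ds m →
      (goodCount out ds m n : ℂ) * y ^ n = coeff n (r ^ ds.length * (r + C y * X * g))) ∧
    (∀ o l ds m, Settled (o ++ [l]) ds m →
      (goodCount (o ++ [l]) (l :: ds) m n : ℂ) * y ^ n = coeff n (r ^ ds.length * g)) := by
  induction n with
  | zero =>
    refine ⟨fun out ds m hs => ?_, fun o l ds m hs => ?_⟩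
    · rw [goodCount_zero _ _ _ hs.abaFree_append]
      simp [h.constantCoeff_eq]
    · rw [goodCount_zero _ _ _ hs.abaFree_append_getLast]
      simp [h.constantCoeff_eq, h.constantCoeff_geo]
  | succ n ih =>
    obtain ⟨ihE, ihT⟩ := ih
    refine ⟨fun out ds m hs => ?_, fun o l ds m hs => ?_⟩
    · obtain ⟨a, ds, rfl⟩ := List.exists_cons_of_ne_nil hs.ds_ne_nil
      obtain ⟨o, l, rfl⟩ := (List.eq_nil_or_concat' out).resolve_left hs.out_ne_nil
      have hl : l ∈ Finset.range m \ (a :: ds).toFinset := by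
        rw [Finset.mem_sdiff, Finset.mem_range, List.mem_toFinset, hs.lt_iff]
        exact ⟨Or.inl (by simp), fun hl => hs.disjoint l hl (by simp)⟩
      rw [goodCount_succ_cons _ _ _ hs.nodup fun x hx => (hs.lt_iff x).2 (Or.inr hx),
        Finset.sum_eq_single_of_mem l hl]
      · have h1 := ihE _ _ _ hs
        have h2 := ihE _ _ _ hs.push
        have h3 := ihT _ _ _ _ hs
        have h4 := sum_goodCount_pop (y := y) (f := fun k => r ^ k * (r + C y * X * g)) ihE
          hs.abaFree_append hs.nodup
          (fun x hx => hs.disjoint x (by simp [hx])) hs.lt_iff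
        rw [← coeff_succ_sub_one]
        have key : r ^ (a :: ds).length * (r + C y * X * g) - 1 = C y * X *
            (r ^ (a :: ds).length * (r + C y * X * g) +
              ∑ j ∈ Finset.range ds.length, r ^ (j + 1) * (r + C y * X * g) +
              r ^ (m :: a :: ds).length * (r + C y * X * g) + r ^ (a :: ds).length * g) := by
          simp only [mul_add (C y * X), h.sum_pow]
          simp only [List.length_cons]
          linear_combination r ^ ds.length * (r + 1) * h.eq
        rw [key, coeff_succ_C_mul_X_mul]
        simp only [map_add]
        rw [← h1, ← h2, ← h3, ← h4]
        push_cast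
        ring
      · intro x hx hxl
        rw [Finset.mem_sdiff, Finset.mem_range, List.mem_toFinset, hs.lt_iff] at hx
        exact goodCount_eq_zero _ _ (not_abaFree_append_cons (hx.1.resolve_right hx.2) hxl)
    · have hlds : l ∉ ds := fun hl => hs.disjoint l hl (by simp)
      have hnd : (l :: ds).Nodup := List.nodup_cons.2 ⟨hlds, hs.nodup⟩
      have hm : ∀ x, x < m ↔ x ∈ o ++ [l] ∨ x ∈ l :: ds := fun x => by
        rw [hs.lt_iff]; simp; tauto
      have hlm : l ≠ m := ((hs.lt_iff l).2 (by simp)).ne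
      rw [goodCount_succ_cons _ _ _ hnd fun x hx => (hm x).2 (Or.inr hx),
        Finset.sum_eq_zero, goodCount_eq_zero (ds := m :: l :: ds)]
      · have h1 := ihT _ _ _ _ hs
        have h4 := sum_goodCount_pop (y := y) (f := fun k => r ^ k * (r + C y * X * g)) ihE
          hs.abaFree_append_getLast hnd hs.disjoint hm
        rw [← coeff_succ_sub_one]
        have key : r ^ ds.length * g - 1 = C y * X * (r ^ ds.length * g +
            ∑ j ∈ Finset.range ds.length, r ^ (j + 1) * (r + C y * X * g)) := by
          simp only [mul_add (C y * X), h.sum_pow]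
          linear_combination r ^ ds.length * h.geo
        rw [key, coeff_succ_C_mul_X_mul]
        simp only [map_add]
        rw [← h1, ← h4]
        push_cast
        ring
      · intro hf
        refine hlm (hf l m ?_).symm
        have : ([l] ++ [m, l]).Sublist ((o ++ [l]) ++ m :: l :: ds) :=
          (List.sublist_append_right _ _).append
            (((List.nil_sublist ds).cons_cons l).cons_cons m)
        exact this
      · intro x hx
        rw [Finset.mem_sdiff, Finset.mem_range, List.mem_toFinset, hm] at hx
        refine goodCount_eq_zero _ _ (not_abaFree_append_cons (hx.1.resolve_right hx.2) ?_)
        rintro rfl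
        exact hx.2 (by simp)

theorem goodCount_nil (h : StackSeries y g r) (n : ℕ) (a : ℕ) (ds : List ℕ) (m : ℕ)
    (hnd : (a :: ds).Nodup) (hm : ∀ x, x < m ↔ x ∈ a :: ds) :
    2 * ((goodCount [] (a :: ds) m n : ℂ) * y ^ n) =
      coeff n (r ^ ds.length * (r ^ 2 + C y * X * g * r + g)) := by
  induction n generalizing a ds m with
  | zero =>
    rw [goodCount_zero _ _ _ (by simpa using abaFree_of_nodup hnd)]
    simp [h.constantCoeff_eq, h.constantCoeff_geo]
    norm_num
  | succ n ih =>
    have hmm : m ∉ a :: ds := fun h => lt_irrefl _ ((hm m).2 h)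
    rw [goodCount_succ_cons _ _ _ hnd fun x hx => (hm x).2 hx, Finset.sum_eq_zero]
    · have h1 := ih _ _ _ hnd hm
      have h2 := ih m (a :: ds) (m + 1) (List.nodup_cons.2 ⟨hmm, hnd⟩) fun x => by
        rw [Nat.lt_succ_iff_lt_or_eq, hm, List.mem_cons (a := x) (b := m), or_comm]
      have h4 := sum_goodCount_pop (y := y) (f := fun k => r ^ k * (r + C y * X * g)) (out := [])
        (goodCount_settled h n).1
        (by simpa using abaFree_of_nodup hnd) hnd (by simp) (m := m) (by simpa using hm)
      have key : r ^ ds.length * (r ^ 2 + C y * X * g * r + g) - 1 - 1 = C y * X *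
          (r ^ ds.length * (r ^ 2 + C y * X * g * r + g) +
            2 * ∑ j ∈ Finset.range ds.length, r ^ (j + 1) * (r + C y * X * g) +
            r ^ (a :: ds).length * (r ^ 2 + C y * X * g * r + g)) := by
        simp only [mul_add (C y * X)]
        rw [mul_left_comm (C y * X) 2, h.sum_pow]
        simp only [List.length_cons]
        linear_combination r ^ ds.length * h.geo + r ^ ds.length * (r + 1) * h.eq
      rw [← coeff_succ_sub_one, ← coeff_succ_sub_one, key, coeff_succ_C_mul_X_mul]
      rw [two_mul (∑ j ∈ Finset.range ds.length, _), map_add, map_add, map_add]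
      rw [← h1, ← h2, ← h4]
      push_cast
      ring
    · intro x hx
      rw [Finset.mem_sdiff, Finset.mem_range, List.mem_toFinset, hm] at hx
      exact absurd hx.1 hx.2

theorem two_mul_sCount (h : StackSeries y g r) (n : ℕ) :
    2 * ((sCount n : ℂ) * y ^ n) = coeff n (r + g) := by
  rw [sCount_eq_goodCount]
  cases n with
  | zero =>
    rw [goodCount_zero _ _ _ (by simpa using abaFree_of_nodup List.nodup_nil)]
    simp [h.constantCoeff_eq, h.constantCoeff_geo]
    norm_num
  | succ n =>
    rw [goodCount_succ]
    have h1 := goodCount_nil h n 0 [] 1 (by simp) (by simp)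
    have key : r + g - 1 - 1 = C y * X *
        (r ^ ([] : List ℕ).length * (r ^ 2 + C y * X * g * r + g)) := by
      simp only [List.length_nil]
      linear_combination h.geo + h.eq
    rw [← coeff_succ_sub_one, ← coeff_succ_sub_one, key, coeff_succ_C_mul_X_mul, ← h1]
    simp
    ring

end GeneratingFunction

section Asymptotics

theorem rpow_neg_three_halves {x : ℝ} (hx : 0 ≤ x) : x ^ (-(3 : ℝ) / 2) = 1 / √x ^ 3 := by
  rw [Real.sqrt_eq_rpow, ← Real.rpow_natCast, ← Real.rpow_mul hx, one_div, ← Real.rpow_neg hx]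
  norm_num

theorem rpow_neg_five_halves {x : ℝ} (hx : 0 ≤ x) : x ^ (-(5 : ℝ) / 2) = 1 / √x ^ 5 := by
  rw [Real.sqrt_eq_rpow, ← Real.rpow_natCast, ← Real.rpow_mul hx, one_div, ← Real.rpow_neg hx]
  norm_num

theorem centralBinom_div_succ (n : ℕ) :
    ((n + 1).centralBinom : ℝ) / 4 ^ (n + 1) =
      (2 * n + 1) / (2 * n + 2) * (n.centralBinom / 4 ^ n) := by
  have h : ((n : ℝ) + 1) * (n + 1).centralBinom = 2 * (2 * n + 1) * n.centralBinom := by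
    exact_mod_cast Nat.succ_mul_centralBinom_succ n
  rw [pow_succ]
  field_simp
  linear_combination 2 * h

theorem exists_centralBinom_sq_bounds : ∃ M : ℝ, 0 < M ∧ ∀ n : ℕ,
    n * ((n.centralBinom : ℝ) / 4 ^ n) ^ 2 ≤ M ∧
      M ≤ (n + 1 / 2) * ((n.centralBinom : ℝ) / 4 ^ n) ^ 2 := by
  set A : ℕ → ℝ := fun n => n * ((n.centralBinom : ℝ) / 4 ^ n) ^ 2 with hA
  set B : ℕ → ℝ := fun n => (n + 1 / 2) * ((n.centralBinom : ℝ) / 4 ^ n) ^ 2 with hB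
  have hmono : Monotone A := by
    refine monotone_nat_of_le_succ fun n => ?_
    simp only [hA, centralBinom_div_succ, mul_pow, ← mul_assoc]
    refine mul_le_mul_of_nonneg_right ?_ (sq_nonneg _)
    push_cast
    rw [div_pow, ← mul_div_assoc, le_div_iff₀ (by positivity)]
    nlinarith [n.cast_nonneg (α := ℝ)]
  have hanti : Antitone B := by
    refine antitone_nat_of_succ_le fun n => ?_
    simp only [hB, centralBinom_div_succ, mul_pow, ← mul_assoc]
    refine mul_le_mul_of_nonneg_right ?_ (sq_nonneg _)
    push_cast
    rw [div_pow, ← mul_div_assoc, div_le_iff₀ (by positivity)]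
    nlinarith [n.cast_nonneg (α := ℝ)]
  have hAB : ∀ n m, A n ≤ B m := fun n m => calc
    A n ≤ A (max n m) := hmono (le_max_left _ _)
    _ ≤ B (max n m) := mul_le_mul_of_nonneg_right (by norm_num) (sq_nonneg _)
    _ ≤ B m := hanti (le_max_right _ _)
  have hbdd : BddAbove (Set.range A) := ⟨B 0, by rintro _ ⟨n, rfl⟩; exact hAB n 0⟩
  refine ⟨⨆ n, A n, lt_of_lt_of_le ?_ (le_ciSup hbdd 1), fun n =>
    ⟨le_ciSup hbdd n, ciSup_le fun k => hAB k n⟩⟩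
  simp [hA, Nat.centralBinom_eq_two_mul_choose]

theorem exists_catalan_asymptotics : ∃ L : ℝ, 0 < L ∧ ∃ C : ℝ, 0 < C ∧ ∀ n : ℕ, 1 ≤ n →
    |(catalan n : ℝ) / 4 ^ n - L * (n : ℝ) ^ (-(3 : ℝ) / 2)| ≤ C * (n : ℝ) ^ (-(5 : ℝ) / 2) := by
  obtain ⟨M, hM, hbd⟩ := exists_centralBinom_sq_bounds
  refine ⟨√M, Real.sqrt_pos.2 hM, 5 / 4 * √M, by positivity, fun n hn => ?_⟩
  obtain ⟨h1, h2⟩ := hbd n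
  have hn0 : (0 : ℝ) < n := by exact_mod_cast hn
  have hcat : (catalan n : ℝ) = n.centralBinom / (n + 1) := by
    rw [eq_div_iff (by positivity), mul_comm]
    exact_mod_cast succ_mul_catalan_eq_centralBinom n
  rw [rpow_neg_three_halves hn0.le, rpow_neg_five_halves hn0.le, hcat, div_right_comm]
  set γ : ℝ := (n.centralBinom : ℝ) / 4 ^ n with hγ
  have hγ0 : 0 ≤ γ := by positivity
  set u := √(n : ℝ) with hu
  have hu0 : 0 < u := Real.sqrt_pos.2 hn0
  have hun : (n : ℝ) = u ^ 2 := (Real.sq_sqrt hn0.le).symm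
  have hlow : u * γ ≤ √M := by
    refine Real.le_sqrt_of_sq_le ?_
    rw [mul_pow, ← hun]
    exact h1
  have hup : √M ≤ u * γ * (1 + 1 / (4 * u ^ 2)) := by
    refine Real.sqrt_le_iff.2 ⟨by positivity, h2.trans ?_⟩
    rw [hun, mul_pow, mul_pow, mul_right_comm]
    refine mul_le_mul_of_nonneg_right ?_ (sq_nonneg _)
    have : u ^ 2 * (1 + 1 / (4 * u ^ 2)) ^ 2 = u ^ 2 + 1 / 2 + 1 / (16 * u ^ 2) := by
      field_simp; ring
    rw [this]
    have : 0 < 1 / (16 * u ^ 2) := by positivity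
    linarith
  rw [hun]
  set v := u * γ with hv
  have hγv : γ = v / u := by rw [hv]; field_simp
  have hv0 : 0 ≤ v := by positivity
  have e1 : γ / (u ^ 2 + 1) ≤ √M * (1 / u ^ 3) := by
    rw [hγv, div_div, mul_one_div]
    exact div_le_div₀ (by positivity) hlow (by positivity) (by nlinarith)
  have e2 : √M * (1 / u ^ 3) ≤ v * (1 + 1 / (4 * u ^ 2)) * (1 / u ^ 3) :=
    mul_le_mul_of_nonneg_right hup (by positivity)
  have e3 : v * (1 + 1 / (4 * u ^ 2)) * (1 / u ^ 3) - γ / (u ^ 2 + 1) ≤ 5 / 4 * v * (1 / u ^ 5) := by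
    have : 5 / 4 * v * (1 / u ^ 5) - (v * (1 + 1 / (4 * u ^ 2)) * (1 / u ^ 3) - γ / (u ^ 2 + 1)) =
        v / (u ^ 5 * (u ^ 2 + 1)) := by
      rw [hγv]; field_simp; ring
    have h0 : 0 ≤ v / (u ^ 5 * (u ^ 2 + 1)) := by positivity
    linarith
  have e4 : 5 / 4 * v * (1 / u ^ 5) ≤ 5 / 4 * √M * (1 / u ^ 5) := by gcongr
  rw [abs_le]
  have : 0 ≤ 5 / 4 * √M * (1 / u ^ 5) := by positivity
  constructor <;> linarith

theorem exists_shift_bound {b : ℕ → ℝ} {L C : ℝ} (hL : 0 ≤ L) (hC : 0 ≤ C)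
    (hb : ∀ n : ℕ, 1 ≤ n →
      |b n - L * (n : ℝ) ^ (-(3 : ℝ) / 2)| ≤ C * (n : ℝ) ^ (-(5 : ℝ) / 2)) :
    ∃ C' : ℝ, ∀ n : ℕ, 1 ≤ n → ∀ k : ℕ,
      |(if k ≤ n then b (n - k) else 0) - L * (n : ℝ) ^ (-(3 : ℝ) / 2)| ≤
        C' * (n : ℝ) ^ (-(5 : ℝ) / 2) * ((k : ℝ) + 1) ^ 3 := by
  have hbdd : ∀ m, |b m| ≤ |b 0| + L + C := by
    intro m
    rcases Nat.eq_zero_or_pos m with rfl | hm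
    · linarith
    · have h1 : (1 : ℝ) ≤ m := by exact_mod_cast hm
      have h3 : (m : ℝ) ^ (-(3 : ℝ) / 2) ≤ 1 :=
        Real.rpow_le_one_of_one_le_of_nonpos h1 (by norm_num)
      have h5 : (m : ℝ) ^ (-(5 : ℝ) / 2) ≤ 1 :=
        Real.rpow_le_one_of_one_le_of_nonpos h1 (by norm_num)
      have h30 : 0 ≤ (m : ℝ) ^ (-(3 : ℝ) / 2) := by positivity
      have := hb m hm
      rw [abs_le] at this
      have e1 : L * (m : ℝ) ^ (-(3 : ℝ) / 2) ≤ L := mul_le_of_le_one_right hL h3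
      have e2 : C * (m : ℝ) ^ (-(5 : ℝ) / 2) ≤ C := mul_le_of_le_one_right hC h5
      have e3 : 0 ≤ L * (m : ℝ) ^ (-(3 : ℝ) / 2) := by positivity
      rw [abs_le]
      constructor <;> linarith [abs_nonneg (b 0)]
  set B := |b 0| + L + C with hB
  have hB0 : 0 ≤ B := by positivity
  refine ⟨32 * C + 24 * L + 8 * (B + L), fun n hn k => ?_⟩
  have hn1 : (1 : ℝ) ≤ n := by exact_mod_cast hn
  have hn0 : (0 : ℝ) ≤ n := by linarith
  have hu1 : 1 ≤ √(n : ℝ) := Real.one_le_sqrt.2 hn1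
  have hun : √(n : ℝ) ^ 2 = n := Real.sq_sqrt hn0
  have hk0 : (0 : ℝ) ≤ k := k.cast_nonneg
  have hk1 : (1 : ℝ) ≤ (k + 1) ^ 3 := one_le_pow₀ (by linarith)
  have hkk : (k : ℝ) ≤ (k + 1) ^ 3 := by
    nlinarith [mul_nonneg hk0 hk0, mul_nonneg hk0 (mul_nonneg hk0 hk0)]
  rw [rpow_neg_three_halves hn0, rpow_neg_five_halves hn0]
  set u := √(n : ℝ) with hu
  have hu0 : 0 < u := by linarith
  by_cases h2k : 2 * k ≤ n
  · rw [if_pos (by omega)]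
    have hm1 : 1 ≤ n - k := by omega
    have hm := hb _ hm1
    have hmn : ((n - k : ℕ) : ℝ) = n - k := by rw [Nat.cast_sub (by omega)]
    have h2k' : 2 * (k : ℝ) ≤ n := by exact_mod_cast h2k
    rw [rpow_neg_three_halves (by positivity), rpow_neg_five_halves (by positivity)] at hm
    have hvn : √((n - k : ℕ) : ℝ) ^ 2 = n - k := by rw [Real.sq_sqrt (by positivity), hmn]
    set v := √((n - k : ℕ) : ℝ) with hv
    have hv0 : 0 < v := Real.sqrt_pos.2 (by exact_mod_cast hm1)
    have huv : u ≤ 2 * v := by nlinarith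
    have hvu : v ≤ u := by nlinarith
    have e5 : 1 / v ^ 5 ≤ 32 * (1 / u ^ 5) := by
      rw [mul_one_div, div_le_div_iff₀ (by positivity) (by positivity)]
      calc 1 * u ^ 5 ≤ 1 * (2 * v) ^ 5 := by gcongr
        _ = 32 * v ^ 5 := by ring
    have e3 : 1 / v ^ 3 - 1 / u ^ 3 ≤ 24 * k * (1 / u ^ 5) := by
      have hkuv : (k : ℝ) = (u - v) * (u + v) := by linear_combination hvn - hun
      have hd : u ^ 3 - v ^ 3 ≤ 3 * k * u := by
        rw [hkuv]
        have : 0 ≤ (u - v) * (2 * u ^ 2 + 2 * u * v - v ^ 2) :=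
          mul_nonneg (by linarith) (by nlinarith)
        nlinarith
      have hu3 : u ^ 3 ≤ 8 * v ^ 3 := by
        calc u ^ 3 ≤ (2 * v) ^ 3 := by gcongr
          _ = 8 * v ^ 3 := by ring
      rw [div_sub_div _ _ (by positivity) (by positivity), mul_one_div,
        div_le_div_iff₀ (by positivity) (by positivity)]
      calc (1 * u ^ 3 - v ^ 3 * 1) * u ^ 5 = (u ^ 3 - v ^ 3) * u ^ 5 := by ring
        _ ≤ 3 * k * u * u ^ 5 := by gcongr
        _ = 3 * k * u ^ 3 * u ^ 3 := by ring
        _ ≤ 3 * k * u ^ 3 * (8 * v ^ 3) := by gcongr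
        _ = 24 * k * (v ^ 3 * u ^ 3) := by ring
    have e0 : 0 ≤ 1 / v ^ 3 - 1 / u ^ 3 := by
      rw [sub_nonneg]; gcongr
    have hp : 0 < 1 / u ^ 5 := by positivity
    calc |b (n - k) - L * (1 / u ^ 3)|
        = |(b (n - k) - L * (1 / v ^ 3)) + L * (1 / v ^ 3 - 1 / u ^ 3)| := by congr 1; ring
      _ ≤ |b (n - k) - L * (1 / v ^ 3)| + |L * (1 / v ^ 3 - 1 / u ^ 3)| := abs_add_le _ _
      _ ≤ C * (1 / v ^ 5) + L * (1 / v ^ 3 - 1 / u ^ 3) := by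
          rw [abs_of_nonneg (mul_nonneg hL e0)]; gcongr
      _ ≤ C * (32 * (1 / u ^ 5)) + L * (24 * k * (1 / u ^ 5)) := by gcongr
      _ = (32 * C * 1 + 24 * L * k + 0 * (k + 1) ^ 3) * (1 / u ^ 5) := by ring
      _ ≤ (32 * C * (k + 1) ^ 3 + 24 * L * (k + 1) ^ 3 + 8 * (B + L) * (k + 1) ^ 3) *
          (1 / u ^ 5) := by gcongr; positivity
      _ = _ := by ring
  · have hbd : |(if k ≤ n then b (n - k) else 0) - L * (1 / u ^ 3)| ≤ B + L := by
      refine (abs_sub _ _).trans (add_le_add ?_ ?_)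
      · split_ifs
        · exact hbdd _
        · simpa using hB0
      · rw [abs_of_nonneg (by positivity)]
        refine mul_le_of_le_one_right hL ?_
        rw [div_le_one (by positivity)]
        exact one_le_pow₀ hu1
    refine hbd.trans ?_
    have h2k' : (n : ℝ) ≤ 2 * k := by exact_mod_cast (not_le.1 h2k).le
    have hk3 : u ^ 5 ≤ 8 * ((k : ℝ) + 1) ^ 3 := calc
      u ^ 5 ≤ u ^ 6 := pow_le_pow_right₀ hu1 (by norm_num)
      _ = (u ^ 2) ^ 3 := by ring
      _ ≤ (2 * (k + 1)) ^ 3 := by gcongr; linarith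
      _ = 8 * ((k : ℝ) + 1) ^ 3 := by ring
    calc B + L ≤ (B + L) * (8 * ((k : ℝ) + 1) ^ 3 / u ^ 5) := by
          refine le_mul_of_one_le_right (by positivity) ?_
          rwa [one_le_div (by positivity)]
      _ = (8 * (B + L)) * (1 / u ^ 5) * (k + 1) ^ 3 := by ring
      _ ≤ _ := by gcongr; nlinarith

theorem exists_convolution_asymptotics {b : ℕ → ℝ} {L C : ℝ} (hL : 0 ≤ L) (hC : 0 ≤ C)
    (hb : ∀ n : ℕ, 1 ≤ n →
      |b n - L * (n : ℝ) ^ (-(3 : ℝ) / 2)| ≤ C * (n : ℝ) ^ (-(5 : ℝ) / 2))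
    {g : ℕ → ℂ} (hg : Summable fun k => ‖g k‖ * ((k : ℝ) + 1) ^ 3) :
    ∃ C' : ℝ, ∀ n : ℕ, 1 ≤ n →
      ‖∑ p ∈ Finset.HasAntidiagonal.antidiagonal n, (b p.1 : ℂ) * g p.2 -
        (L * (n : ℝ) ^ (-(3 : ℝ) / 2) : ℝ) * ∑' k, g k‖ ≤ C' * (n : ℝ) ^ (-(5 : ℝ) / 2) := by
  obtain ⟨C', hC'⟩ := exists_shift_bound hL hC hb
  have hgs : Summable g := by
    refine Summable.of_norm_bounded hg fun k => le_mul_of_one_le_right (norm_nonneg _) ?_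
    exact one_le_pow₀ (by linarith [k.cast_nonneg (α := ℝ)])
  refine ⟨C' * ∑' k, ‖g k‖ * ((k : ℝ) + 1) ^ 3, fun n hn => ?_⟩
  have hs : HasSum (fun k => ((if k ≤ n then b (n - k) else 0 : ℝ) : ℂ) * g k)
      (∑ p ∈ Finset.HasAntidiagonal.antidiagonal n, (b p.1 : ℂ) * g p.2) := by
    rw [Finset.Nat.sum_antidiagonal_eq_sum_range_succ_mk, ← Finset.sum_range_reflect]
    have : ∑ k ∈ Finset.range (n + 1), ((if k ≤ n then b (n - k) else 0 : ℝ) : ℂ) * g k =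
        ∑ j ∈ Finset.range n.succ, (b (n.succ - 1 - j) : ℂ) * g (n - (n.succ - 1 - j)) := by
      refine Finset.sum_congr rfl fun k hk => ?_
      have hk' : k ≤ n := Nat.lt_succ_iff.1 (Finset.mem_range.1 hk)
      rw [if_pos hk', Nat.succ_sub_one, Nat.sub_sub_self hk']
    rw [← this]
    refine hasSum_sum_of_ne_finset_zero fun k hk => ?_
    rw [if_neg (by simpa [Nat.lt_succ_iff] using hk)]
    simp
  have hdiff := hs.sub (hgs.hasSum.mul_left ((L * (n : ℝ) ^ (-(3 : ℝ) / 2) : ℝ) : ℂ))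
  rw [← hdiff.tsum_eq]
  have hsum := hg.hasSum.mul_left (C' * (n : ℝ) ^ (-(5 : ℝ) / 2))
  refine (tsum_of_norm_bounded hsum fun k => ?_).trans (le_of_eq (by ring))
  rw [← sub_mul, norm_mul, ← Complex.ofReal_sub, Complex.norm_real, Real.norm_eq_abs]
  calc _ ≤ C' * (n : ℝ) ^ (-(5 : ℝ) / 2) * ((k : ℝ) + 1) ^ 3 * ‖g k‖ :=
        mul_le_mul_of_nonneg_right (hC' n hn k) (norm_nonneg _)
    _ = _ := by ring

end Asymptotics

section WeightedSummability

open PowerSeries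

/-- The coefficients of `f` are absolutely summable with weight `(k + 1) ^ 3`. -/
def CubicSummable (f : PowerSeries ℂ) : Prop :=
  Summable fun k : ℕ => ‖coeff k f‖ * ((k : ℝ) + 1) ^ 3

theorem CubicSummable.summable_norm {f : PowerSeries ℂ} (hf : CubicSummable f) :
    Summable fun k => ‖coeff k f‖ :=
  Summable.of_nonneg_of_le (fun _ => norm_nonneg _) (fun k => le_mul_of_one_le_right (norm_nonneg _)
    (one_le_pow₀ (by linarith [k.cast_nonneg (α := ℝ)]))) hf

theorem CubicSummable.add {f g : PowerSeries ℂ} (hf : CubicSummable f) (hg : CubicSummable g) :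
    CubicSummable (f + g) := by
  refine Summable.of_nonneg_of_le (fun _ => by positivity) (fun k => ?_) (Summable.add hf hg)
  rw [map_add, ← add_mul]
  exact mul_le_mul_of_nonneg_right (norm_add_le _ _) (by positivity)

theorem CubicSummable.neg {f : PowerSeries ℂ} (hf : CubicSummable f) : CubicSummable (-f) := by
  simpa [CubicSummable] using hf

theorem CubicSummable.sub {f g : PowerSeries ℂ} (hf : CubicSummable f) (hg : CubicSummable g) :
    CubicSummable (f - g) := by
  rw [sub_eq_add_neg]
  exact hf.add hg.neg

theorem CubicSummable.mul {f g : PowerSeries ℂ} (hf : CubicSummable f) (hg : CubicSummable g) :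
    CubicSummable (f * g) := by
  have hf' : Summable fun k : ℕ => ‖‖coeff k f‖ * ((k : ℝ) + 1) ^ 3‖ := Summable.norm hf
  have hg' : Summable fun k : ℕ => ‖‖coeff k g‖ * ((k : ℝ) + 1) ^ 3‖ := Summable.norm hg
  have h := summable_norm_sum_mul_antidiagonal_of_summable_norm hf' hg'
  refine Summable.of_nonneg_of_le (fun _ => by positivity) (fun n => ?_) h
  rw [coeff_mul]
  refine le_trans ?_ (le_abs_self _)
  refine (mul_le_mul_of_nonneg_right (norm_sum_le _ _) (by positivity)).trans ?_
  rw [Finset.sum_mul]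
  refine Finset.sum_le_sum fun p hp => ?_
  have hn : (n : ℝ) = p.1 + p.2 := by
    exact_mod_cast (Finset.HasAntidiagonal.mem_antidiagonal.1 hp).symm
  have hle : ((n : ℝ) + 1) ^ 3 ≤ ((p.1 : ℝ) + 1) ^ 3 * ((p.2 : ℝ) + 1) ^ 3 := by
    rw [← mul_pow]
    refine pow_le_pow_left₀ (by positivity) ?_ 3
    rw [hn]
    nlinarith [mul_nonneg (p.1.cast_nonneg (α := ℝ)) (p.2.cast_nonneg (α := ℝ))]
  rw [norm_mul]
  calc _ ≤ ‖coeff p.1 f‖ * ‖coeff p.2 g‖ * (((p.1 : ℝ) + 1) ^ 3 * ((p.2 : ℝ) + 1) ^ 3) :=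
        mul_le_mul_of_nonneg_left hle (by positivity)
    _ = _ := by ring

theorem cubicSummable_of_norm_le {f : PowerSeries ℂ} {z : ℂ} (hz : ‖z‖ < 1)
    (hf : ∀ k, ‖coeff k f‖ ≤ ‖z‖ ^ k) : CubicSummable f := by
  have h3 := summable_pow_mul_geometric_of_norm_lt_one 3 (r := ‖z‖) (by simpa using hz)
  have h0 := summable_geometric_of_lt_one (norm_nonneg z) hz
  refine Summable.of_nonneg_of_le (fun _ => by positivity) (fun k => ?_)
    ((h3.add h0).mul_left 4)
  have hk : (0 : ℝ) ≤ k := k.cast_nonneg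
  have hle : ((k : ℝ) + 1) ^ 3 ≤ 4 * (k ^ 3 + 1) := by
    nlinarith [mul_nonneg (add_nonneg hk zero_le_one) (sq_nonneg ((k : ℝ) - 1))]
  calc _ ≤ ‖z‖ ^ k * (4 * ((k : ℝ) ^ 3 + 1)) :=
        mul_le_mul (hf k) hle (by positivity) (by positivity)
    _ = _ := by ring

theorem cubicSummable_one : CubicSummable 1 := by
  refine summable_of_ne_finset_zero (s := {0}) fun k hk => ?_
  have : k ≠ 0 := by simpa using hk
  simp [coeff_one, this]

theorem cubicSummable_C_mul_X (z : ℂ) : CubicSummable (C z * X) := by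
  refine summable_of_ne_finset_zero (s := {1}) fun k hk => ?_
  have : k ≠ 1 := by simpa using hk
  simp [coeff_X, this]

/-- The sum of the coefficients. -/
noncomputable def coeffSum (f : PowerSeries ℂ) : ℂ := ∑' k, coeff k f

theorem coeffSum_mul {f g : PowerSeries ℂ} (hf : CubicSummable f) (hg : CubicSummable g) :
    coeffSum (f * g) = coeffSum f * coeffSum g := by
  simp only [coeffSum, coeff_mul]
  exact (tsum_mul_tsum_eq_tsum_sum_antidiagonal_of_summable_norm
    hf.summable_norm hg.summable_norm).symm

theorem coeffSum_one_sub (z : ℂ) : coeffSum (1 - C z * X) = 1 - z := by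
  rw [coeffSum, tsum_eq_sum (s := Finset.range 2)]
  · simp [coeff_one, coeff_X]
  · intro k hk
    have h0 : k ≠ 0 := by rintro rfl; simp at hk
    have h1 : k ≠ 1 := by rintro rfl; simp at hk
    simp [coeff_one, coeff_X, h0, h1]

theorem CubicSummable.exists_bound {f : PowerSeries ℂ} (hf : CubicSummable f) :
    ∃ B : ℝ, ∀ n : ℕ, 1 ≤ n → ‖coeff (n + 1) f‖ ≤ B * (n : ℝ) ^ (-(5 : ℝ) / 2) := by
  refine ⟨∑' k : ℕ, ‖coeff k f‖ * ((k : ℝ) + 1) ^ 3, fun n hn => ?_⟩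
  have h1 := hf.le_tsum (n + 1) fun _ _ => by positivity
  have hn1 : (1 : ℝ) ≤ n := by exact_mod_cast hn
  have hpos : (0 : ℝ) < (n : ℝ) ^ (-(5 : ℝ) / 2) := by positivity
  have h2 : (1 : ℝ) ≤ (((n + 1 : ℕ) : ℝ) + 1) ^ 3 * (n : ℝ) ^ (-(5 : ℝ) / 2) := calc
    (1 : ℝ) ≤ (n : ℝ) ^ (1 / 2 : ℝ) := Real.one_le_rpow hn1 (by norm_num)
    _ = (n : ℝ) ^ 3 * (n : ℝ) ^ (-(5 : ℝ) / 2) := by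
      rw [← Real.rpow_natCast, ← Real.rpow_add (by linarith)]
      norm_num
    _ ≤ _ := by gcongr; push_cast; linarith
  calc ‖coeff (n + 1) f‖ ≤ ‖coeff (n + 1) f‖ *
        ((((n + 1 : ℕ) : ℝ) + 1) ^ 3 * (n : ℝ) ^ (-(5 : ℝ) / 2)) :=
        le_mul_of_one_le_right (norm_nonneg _) h2
    _ = ‖coeff (n + 1) f‖ * (((n + 1 : ℕ) : ℝ) + 1) ^ 3 * (n : ℝ) ^ (-(5 : ℝ) / 2) := by ring
    _ ≤ _ := mul_le_mul_of_nonneg_right h1 hpos.le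

end WeightedSummability

section SquareRoot

open PowerSeries

/-- The generating function of the Catalan numbers divided by `4 ^ n`. -/
noncomputable def scaledCatalan : PowerSeries ℂ := PowerSeries.mk fun n => (catalan n : ℂ) / 4 ^ n

theorem scaledCatalan_eq : scaledCatalan = 1 + C (1 / 4) * X * scaledCatalan ^ 2 := by
  have h : scaledCatalan =
      rescale (1 / 4 : ℂ) (PowerSeries.map (Nat.castRingHom ℂ) catalanSeries) := by
    ext n
    simp [scaledCatalan, div_eq_mul_inv, mul_comm]
  have := congrArg (fun f => rescale (1 / 4 : ℂ) (PowerSeries.map (Nat.castRingHom ℂ) f))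
    catalanSeries_sq_mul_X_add_one
  simp only [map_add, map_mul, map_pow, map_one, PowerSeries.map_X, rescale_X, ← h] at this
  linear_combination -this

/-- The power series of `√(1 - X)`. -/
noncomputable def sqrtOneSub : PowerSeries ℂ := 1 - C (1 / 2) * X * scaledCatalan

theorem sqrtOneSub_sq : sqrtOneSub ^ 2 = 1 - X := by
  have h2 : (C (1 / 2 : ℂ)) ^ 2 = C (1 / 4) := by rw [← map_pow]; norm_num
  have h1 : 2 * C (1 / 2 : ℂ) = 1 := by
    rw [← map_ofNat (C (R := ℂ)) 2, ← map_mul]; norm_num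
  rw [sqrtOneSub]
  linear_combination X ^ 2 * scaledCatalan ^ 2 * h2 - X * scaledCatalan * h1 - X * scaledCatalan_eq

theorem norm_coeff_sqrtOneSub_le (n : ℕ) : ‖coeff n sqrtOneSub‖ ≤ 1 := by
  cases n with
  | zero => simp [sqrtOneSub]
  | succ n =>
    have h : (catalan n : ℝ) ≤ 4 ^ n := by
      rw [catalan_eq_centralBinom_div]
      exact_mod_cast (Nat.div_le_self _ _).trans (Nat.centralBinom_le_four_pow n)
    have : ‖coeff (n + 1) sqrtOneSub‖ = (catalan n : ℝ) / 4 ^ n / 2 := by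
      rw [sqrtOneSub, map_sub, mul_assoc, coeff_C_mul, coeff_succ_X_mul, scaledCatalan, coeff_mk]
      simp [coeff_one]
      ring
    rw [this, div_div, div_le_one (by positivity)]
    linarith [pow_pos (four_pos (α := ℝ)) n]

theorem rescale_sqrtOneSub_sq (z : ℂ) : (rescale z sqrtOneSub) ^ 2 = 1 - C z * X := by
  rw [← map_pow, sqrtOneSub_sq, map_sub, map_one, rescale_X]

theorem constantCoeff_rescale_sqrtOneSub (z : ℂ) : constantCoeff (rescale z sqrtOneSub) = 1 := by
  rw [← coeff_zero_eq_constantCoeff_apply, coeff_rescale]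
  simp [sqrtOneSub]

theorem cubicSummable_rescale_sqrtOneSub {z : ℂ} (hz : ‖z‖ < 1) :
    CubicSummable (rescale z sqrtOneSub) := by
  refine cubicSummable_of_norm_le hz fun k => ?_
  rw [coeff_rescale, norm_mul, norm_pow]
  exact mul_le_of_le_one_right (by positivity) (norm_coeff_sqrtOneSub_le k)

/-- The geometric series of `z * X`. -/
noncomputable def geomSeries (z : ℂ) : PowerSeries ℂ := PowerSeries.mk fun n => z ^ n

theorem geomSeries_eq (z : ℂ) : geomSeries z = 1 + C z * X * geomSeries z := by
  ext n
  cases n with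
  | zero => simp [geomSeries]
  | succ n =>
    rw [map_add, coeff_succ_C_mul_X_mul]
    simp [geomSeries, coeff_one, pow_succ']

theorem cubicSummable_geomSeries {z : ℂ} (hz : ‖z‖ < 1) : CubicSummable (geomSeries z) :=
  cubicSummable_of_norm_le hz fun k => by simp [geomSeries]

theorem exists_stackSeries {y : ℂ} (hy : y ≠ 0) {H : PowerSeries ℂ} (hH0 : constantCoeff H = 1)
    (hH : H ^ 2 * (1 - X) =
      (1 - C y * X - (C y * X) ^ 2) ^ 2 - 4 * (C y * X) * (1 - C y * X) ^ 2) :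
    ∃ r : PowerSeries ℂ, StackSeries y (geomSeries y) r ∧
      2 * (C y * X) * r = geomSeries y * (1 - C y * X - (C y * X) ^ 2) -
        geomSeries y * (sqrtOneSub * H) := by
  have hX : (X : PowerSeries ℂ) ∣ 1 - C y * X - (C y * X) ^ 2 - sqrtOneSub * H := by
    rw [X_dvd_iff]
    simp [sqrtOneSub, hH0]
  obtain ⟨P, hP⟩ := hX
  have hCy : 2 * C y * C (1 / (2 * y)) = 1 := by
    rw [← map_ofNat (C (R := ℂ)) 2, ← map_mul, ← map_mul, mul_one_div_cancel, map_one]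
    simpa using hy
  have hg := geomSeries_eq y
  set g := geomSeries y with hgdef
  have hlin : 2 * (C y * X) * (C (1 / (2 * y)) * g * P) =
      g * (1 - C y * X - (C y * X) ^ 2) - g * (sqrtOneSub * H) := by
    linear_combination X * g * P * hCy - g * hP
  refine ⟨C (1 / (2 * y)) * g * P, ⟨hg, ?_⟩, hlin⟩
  set r := C (1 / (2 * y)) * g * P with hr
  set t : PowerSeries ℂ := C y * X with ht
  have ht0 : (4 : PowerSeries ℂ) * t ≠ 0 := by
    refine mul_ne_zero (fun h => ?_) (mul_ne_zero (by simpa using hy) X_ne_zero)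
    rw [← map_ofNat (C (R := ℂ)) 4] at h
    simpa using congrArg constantCoeff h
  have hsq : (2 * t * r - g * (1 - t - t ^ 2)) ^ 2 =
      g ^ 2 * ((1 - t - t ^ 2) ^ 2 - 4 * t * (1 - t) ^ 2) := by
    rw [hlin, ← hH, ← sqrtOneSub_sq]
    ring
  have hg1 : g * (1 - t) = 1 := by linear_combination hg
  have hg2 : g ^ 2 * (1 - t) ^ 2 = 1 := by rw [← mul_pow, hg1, one_pow]
  apply mul_left_cancel₀ ht0
  linear_combination -hsq + 4 * t * hg2 - 4 * t * r * hg1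

end SquareRoot

section Main

open PowerSeries

theorem four_mul_sCount {y : ℂ} (hy : y ≠ 0) {H : PowerSeries ℂ} (hH0 : constantCoeff H = 1)
    (hH : H ^ 2 * (1 - X) =
      (1 - C y * X - (C y * X) ^ 2) ^ 2 - 4 * (C y * X) * (1 - C y * X) ^ 2) (n : ℕ) :
    4 * y * ((sCount n : ℂ) * y ^ n) =
      coeff (n + 1) (geomSeries y * (1 + C y * X - (C y * X) ^ 2) - geomSeries y * H) +
        1 / 2 * coeff n (scaledCatalan * (geomSeries y * H)) := by
  obtain ⟨r, hr, hlin⟩ := exists_stackSeries hy hH0 hH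
  have h : C y * X * (C 2 * (r + geomSeries y)) =
      geomSeries y * (1 + C y * X - (C y * X) ^ 2) - geomSeries y * H +
        C (1 / 2) * X * (scaledCatalan * (geomSeries y * H)) := by
    rw [sqrtOneSub] at hlin
    rw [map_ofNat]
    linear_combination hlin
  have h' := congrArg (coeff (n + 1)) h
  rw [map_add, coeff_succ_C_mul_X_mul, coeff_succ_C_mul_X_mul, coeff_C_mul,
    ← two_mul_sCount hr] at h'
  linear_combination h'

theorem exists_asymptotics {y : ℝ} (hy0 : 0 < y) (hy1 : y < 1) {H : PowerSeries ℂ}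
    (hH0 : constantCoeff H = 1)
    (hH : H ^ 2 * (1 - X) =
      (1 - C (y : ℂ) * X - (C (y : ℂ) * X) ^ 2) ^ 2 -
        4 * (C (y : ℂ) * X) * (1 - C (y : ℂ) * X) ^ 2)
    (hHs : CubicSummable H) {γ : ℝ} (hγ0 : γ ≠ 0) (hγ : coeffSum (geomSeries y * H) = γ) :
    ∃ K : ℝ, 0 < K ∧ ∃ D : ℝ, 0 < D ∧ ∀ n : ℕ, 1 ≤ n →
      |(sCount n : ℝ) - K * (1 / y) ^ n * (n : ℝ) ^ (-(3 : ℝ) / 2)| ≤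
        D * (1 / y) ^ n * (n : ℝ) ^ (-(5 : ℝ) / 2) := by
  have hy : (y : ℂ) ≠ 0 := by exact_mod_cast hy0.ne'
  have hg : CubicSummable (geomSeries (y : ℂ)) :=
    cubicSummable_geomSeries (by simpa [abs_of_pos hy0] using hy1)
  have hG := hg.mul hHs
  have ht := cubicSummable_C_mul_X (y : ℂ)
  have hA : CubicSummable (geomSeries (y : ℂ) * (1 + C (y : ℂ) * X - (C (y : ℂ) * X) ^ 2) -
      geomSeries (y : ℂ) * H) := by
    rw [sq]
    exact (hg.mul ((cubicSummable_one.add ht).sub (ht.mul ht))).sub hG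
  obtain ⟨A, hA⟩ := hA.exists_bound
  obtain ⟨L, hL, M, hM, hLM⟩ := exists_catalan_asymptotics
  obtain ⟨N, hN⟩ := exists_convolution_asymptotics hL.le hM.le hLM hG
  set K : ℝ := L * γ / (8 * y) with hK
  set D : ℝ := (|A| + |N| + 1) / (4 * y) with hD
  have hD0 : 0 < D := by positivity
  have key : ∀ n : ℕ, 1 ≤ n →
      |(sCount n : ℝ) * y ^ n - K * (n : ℝ) ^ (-(3 : ℝ) / 2)| ≤ D * (n : ℝ) ^ (-(5 : ℝ) / 2) := by
    intro n hn
    have h1 := hA n hn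
    have h2 := hN n hn
    have h3 := four_mul_sCount hy hH0 hH n
    have hsum : ∑ p ∈ Finset.HasAntidiagonal.antidiagonal n,
        (((catalan p.1 : ℝ) / 4 ^ p.1 : ℝ) : ℂ) * coeff p.2 (geomSeries (y : ℂ) * H) =
          coeff n (scaledCatalan * (geomSeries (y : ℂ) * H)) := by
      rw [coeff_mul]
      simp [scaledCatalan]
    rw [hsum, ← coeffSum, hγ] at h2
    have hpos : (0 : ℝ) < (n : ℝ) ^ (-(5 : ℝ) / 2) := by positivity
    set u : ℝ := (n : ℝ) ^ (-(3 : ℝ) / 2)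
    set v : ℝ := (n : ℝ) ^ (-(5 : ℝ) / 2)
    have h4 : (((4 * y) * ((sCount n : ℝ) * y ^ n - K * u) : ℝ) : ℂ) =
        coeff (n + 1) (geomSeries (y : ℂ) * (1 + C (y : ℂ) * X - (C (y : ℂ) * X) ^ 2) -
          geomSeries (y : ℂ) * H) +
        1 / 2 * (coeff n (scaledCatalan * (geomSeries (y : ℂ) * H)) - (L * u : ℝ) * (γ : ℂ)) := by
      have hKy : (4 * y) * (K * u) = 1 / 2 * (L * u * γ) := by
        rw [hK]; field_simp; ring
      rw [mul_sub, hKy]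
      push_cast
      linear_combination h3
    have h5 := congrArg norm h4
    rw [Complex.norm_real, Real.norm_eq_abs, abs_mul, abs_of_pos (by positivity : 0 < 4 * y)] at h5
    have h6 : (4 * y) * |(sCount n : ℝ) * y ^ n - K * u| ≤ (|A| + |N| + 1) * v := by
      rw [h5]
      refine (norm_add_le _ _).trans ?_
      rw [norm_mul]
      have h7 : ‖(1 / 2 : ℂ)‖ ≤ 1 := by norm_num
      have h8 := mul_le_of_le_one_left (norm_nonneg
        (coeff n (scaledCatalan * (geomSeries (y : ℂ) * H)) - (L * u : ℝ) * (γ : ℂ))) h7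
      nlinarith [mul_le_mul_of_nonneg_right (le_abs_self A) hpos.le,
        mul_le_mul_of_nonneg_right (le_abs_self N) hpos.le]
    have h7 : D * v = (|A| + |N| + 1) * v / (4 * y) := by rw [hD]; ring
    rw [h7, le_div_iff₀ (by positivity)]
    linarith
  have hK0 : 0 < K := by
    refine lt_of_le_of_ne ?_ (by rw [hK]; positivity)
    by_contra! hneg
    obtain ⟨n, hn⟩ := exists_nat_gt (D / -K)
    have hn0 : (0 : ℝ) < n := (div_pos hD0 (neg_pos.2 hneg)).trans hn
    have hn1 : 1 ≤ n := by exact_mod_cast hn0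
    have h1 := (le_abs_self _).trans (key n hn1)
    have h2 : (n : ℝ) ^ (-(3 : ℝ) / 2) = n * (n : ℝ) ^ (-(5 : ℝ) / 2) := by
      rw [← Real.rpow_one_add' hn0.le (by norm_num)]
      norm_num
    have hpos : (0 : ℝ) < (n : ℝ) ^ (-(5 : ℝ) / 2) := by positivity
    have h3 : 0 ≤ (sCount n : ℝ) * y ^ n := by positivity
    rw [div_lt_iff₀ (neg_pos.2 hneg)] at hn
    rw [h2] at h1
    nlinarith [mul_lt_mul_of_pos_right hn hpos]
  refine ⟨K, hK0, D, hD0, fun n hn => ?_⟩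
  have h := key n hn
  have hyn : 0 < y ^ n := pow_pos hy0 n
  have e : (sCount n : ℝ) - K * (1 / y) ^ n * (n : ℝ) ^ (-(3 : ℝ) / 2) =
      ((sCount n : ℝ) * y ^ n - K * (n : ℝ) ^ (-(3 : ℝ) / 2)) * (1 / y) ^ n := by
    rw [one_div, inv_pow]
    field_simp
  rw [e, abs_mul, abs_of_pos (by positivity : 0 < (1 / y) ^ n)]
  calc _ ≤ D * (n : ℝ) ^ (-(5 : ℝ) / 2) * (1 / y) ^ n := by gcongr
    _ = _ := by ring

theorem coeffSum_geomSeries_mul_sq {y : ℂ} (hy : ‖y‖ < 1) {H : PowerSeries ℂ}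
    (hH : CubicSummable H) {a b c : ℂ}
    (hsq : H ^ 2 = (1 - C a * X) * ((1 - C b * X) * (1 - C c * X))) :
    (coeffSum (geomSeries y * H) * (1 - y)) ^ 2 = (1 - a) * ((1 - b) * (1 - c)) := by
  have hlin (z : ℂ) : CubicSummable (1 - C z * X) := cubicSummable_one.sub (cubicSummable_C_mul_X z)
  have hG := (cubicSummable_geomSeries hy).mul hH
  have h1 : geomSeries y * H * (1 - C y * X) = H := by linear_combination H * geomSeries_eq y
  rw [← coeffSum_one_sub, ← coeffSum_mul hG (hlin y), h1, sq, ← coeffSum_mul hH hH, ← sq, hsq,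
    coeffSum_mul (hlin a) ((hlin b).mul (hlin c)), coeffSum_mul (hlin b) (hlin c)]
  simp only [coeffSum_one_sub]

theorem exists_asymptotics_of_quadratic {y k l : ℝ} (hy0 : 0 < y) (hy1 : y < 1) (hl0 : 0 < l)
    (hl1 : l < 1) (hadd : k + l = 6) (hmul : k * l = 1) (hy : y ^ 2 = y - l) (hky : k * y < 2) :
    ∃ K : ℝ, 0 < K ∧ ∃ D : ℝ, 0 < D ∧ ∀ n : ℕ, 1 ≤ n →
      |(sCount n : ℝ) - K * (1 / y) ^ n * (n : ℝ) ^ (-(3 : ℝ) / 2)| ≤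
        D * (1 / y) ^ n * (n : ℝ) ^ (-(5 : ℝ) / 2) := by
  have ha : k * y ^ 2 = k * y - 1 := by rw [hy, mul_sub, hmul]
  have hk0 : 0 < k := by linarith
  set b : ℂ := ⟨y * l / 2, y * √(l - l ^ 2 / 4)⟩ with hb
  set c : ℂ := ⟨y * l / 2, -(y * √(l - l ^ 2 / 4))⟩ with hc
  have hs : √(l - l ^ 2 / 4) ^ 2 = l - l ^ 2 / 4 := Real.sq_sqrt (by nlinarith)
  have hbc_add : b + c = ((y * l : ℝ) : ℂ) := by
    apply Complex.ext
    · simp [hb, hc]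
    · simp [hb, hc]
  have hbc_mul : b * c = ((y ^ 2 * l : ℝ) : ℂ) := by
    apply Complex.ext
    · rw [Complex.mul_re, Complex.ofReal_re]
      linear_combination y ^ 2 * hs
    · rw [Complex.mul_im, Complex.ofReal_im]
      ring
  have hyl : y ^ 2 * l < 1 := by nlinarith
  have hbn : ‖b‖ < 1 := by
    rw [← sq_lt_one_iff₀ (norm_nonneg b), ← Complex.normSq_eq_norm_sq, Complex.normSq_apply]
    linear_combination hyl + y ^ 2 * hs
  have hcn : ‖c‖ < 1 := by
    rw [← sq_lt_one_iff₀ (norm_nonneg c), ← Complex.normSq_eq_norm_sq, Complex.normSq_apply]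
    linear_combination hyl + y ^ 2 * hs
  have han : ‖((k * y ^ 2 : ℝ) : ℂ)‖ < 1 := by
    rw [Complex.norm_real, Real.norm_of_nonneg (by positivity)]
    linarith
  have hyn : ‖(y : ℂ)‖ < 1 := by
    rwa [Complex.norm_real, Real.norm_of_nonneg hy0.le]
  set H := rescale ((k * y ^ 2 : ℝ) : ℂ) sqrtOneSub *
    (rescale b sqrtOneSub * rescale c sqrtOneSub) with hHdef
  have hHs : CubicSummable H := (cubicSummable_rescale_sqrtOneSub han).mul
    ((cubicSummable_rescale_sqrtOneSub hbn).mul (cubicSummable_rescale_sqrtOneSub hcn))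
  have hH0 : constantCoeff H = 1 := by
    simp [hHdef, constantCoeff_rescale_sqrtOneSub]
  have hsq : H ^ 2 = (1 - C ((k * y ^ 2 : ℝ) : ℂ) * X) * ((1 - C b * X) * (1 - C c * X)) := by
    simp only [hHdef, mul_pow, rescale_sqrtOneSub_sq]
  have hH : H ^ 2 * (1 - X) =
      (1 - C (y : ℂ) * X - (C (y : ℂ) * X) ^ 2) ^ 2 -
        4 * (C (y : ℂ) * X) * (1 - C (y : ℂ) * X) ^ 2 := by
    have e1 : 1 + C ((k * y ^ 2 : ℝ) : ℂ) = C (k : ℂ) * C (y : ℂ) := by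
      rw [ha, ← map_one C, ← map_add, ← map_mul]
      push_cast
      ring_nf
    have e2 : C ((k * y ^ 2 : ℝ) : ℂ) = C (k : ℂ) * C (y : ℂ) ^ 2 := by simp
    have e3 : C b + C c = C (y : ℂ) * C (l : ℂ) := by
      rw [← map_add, hbc_add, ← map_mul]
      push_cast
      rfl
    have e4 : C b * C c = C (y : ℂ) ^ 2 * C (l : ℂ) := by
      rw [← map_mul, hbc_mul]
      simp
    have e5 : C (k : ℂ) + C (l : ℂ) = 6 := by
      rw [← map_add, ← map_ofNat (C (R := ℂ)) 6]
      exact_mod_cast congrArg (fun x : ℝ => C (x : ℂ)) hadd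
    have e6 : C (k : ℂ) * C (l : ℂ) = 1 := by
      rw [← map_mul, ← map_one (C (R := ℂ))]
      exact_mod_cast congrArg (fun x : ℝ => C (x : ℂ)) hmul
    have f1 : (1 - C ((k * y ^ 2 : ℝ) : ℂ) * X) * (1 - X) =
        1 - C (k : ℂ) * (C (y : ℂ) * X) + C (k : ℂ) * (C (y : ℂ) * X) ^ 2 := by
      linear_combination -X * e1 + X ^ 2 * e2
    have f2 : (1 - C b * X) * (1 - C c * X) =
        1 - C (l : ℂ) * (C (y : ℂ) * X) + C (l : ℂ) * (C (y : ℂ) * X) ^ 2 := by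
      linear_combination -X * e3 + X ^ 2 * e4
    rw [hsq, mul_right_comm, f1, f2]
    generalize C (y : ℂ) * X = t
    linear_combination (t ^ 2 - t) * e5 + (t ^ 2 - 2 * t ^ 3 + t ^ 4) * e6
  set ρ : ℝ := (1 - k * y ^ 2) * (1 - y * l + y ^ 2 * l) with hρ
  have hρ0 : 0 < ρ := by
    refine mul_pos (by linarith) ?_
    nlinarith [mul_pos hy0 hl0, mul_pos (pow_pos hy0 2) hl0]
  have hΓ : (coeffSum (geomSeries (y : ℂ) * H) * (1 - y)) ^ 2 = ((√ρ : ℝ) : ℂ) ^ 2 := by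
    rw [coeffSum_geomSeries_mul_sq hyn hHs hsq, ← Complex.ofReal_pow, Real.sq_sqrt hρ0.le, hρ]
    have e : (1 - b) * (1 - c) = ((1 - y * l + y ^ 2 * l : ℝ) : ℂ) := by
      push_cast at hbc_add hbc_mul ⊢
      linear_combination hbc_mul - hbc_add
    rw [e]
    push_cast
    rfl
  have hy1' : (1 - (y : ℂ)) ≠ 0 := by
    rw [sub_ne_zero]
    exact_mod_cast hy1.ne'
  have hρs : 0 < √ρ := Real.sqrt_pos.2 hρ0
  have hd : 0 < 1 - y := sub_pos.2 hy1
  rcases sq_eq_sq_iff_eq_or_eq_neg.1 hΓ with h | h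
  · refine exists_asymptotics hy0 hy1 hH0 hH hHs (γ := √ρ / (1 - y)) (by positivity) ?_
    rw [eq_div_of_mul_eq hy1' h]
    push_cast
    rfl
  · refine exists_asymptotics hy0 hy1 hH0 hH hHs (γ := -√ρ / (1 - y))
      (div_ne_zero (neg_ne_zero.2 hρs.ne') hd.ne') ?_
    rw [eq_div_of_mul_eq hy1' h]
    push_cast
    rfl

end Main

/-- Asymptotics: with `x₀ = (1 - √(8√2 - 11))/2` the smallest positive root of
`1 - 6x + 7x² - 2x³ + x⁴ = 0` and `c = 1/x₀ = 4.5464⋯`, the number `s(n)` of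
standardized sock sequences of length `n` that are `1`-stack-sortable under
`φ_{aba}` satisfies `s(n) = K·cⁿ·n^{-3/2} + O(cⁿ·n^{-5/2})` for some constant
`K > 0`. -/
theorem asymptotics_of_sCount :
    let x₀ : ℝ := (1 - Real.sqrt (8 * Real.sqrt 2 - 11)) / 2
    let c : ℝ := 1 / x₀
    (0 < x₀) ∧
    (1 - 6 * x₀ + 7 * x₀ ^ 2 - 2 * x₀ ^ 3 + x₀ ^ 4 = 0) ∧
    (∀ y : ℝ, 0 < y → 1 - 6 * y + 7 * y ^ 2 - 2 * y ^ 3 + y ^ 4 = 0 → x₀ ≤ y) ∧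
    ∃ K : ℝ, 0 < K ∧ ∃ C : ℝ, 0 < C ∧
      ∀ n : ℕ, 1 ≤ n →
        |(sCount n : ℝ) - K * c ^ n * (n : ℝ) ^ (-(3 : ℝ) / 2)|
          ≤ C * c ^ n * (n : ℝ) ^ (-(5 : ℝ) / 2) := by
  have hq2 : √(2 : ℝ) ^ 2 = 2 := Real.sq_sqrt (by norm_num)
  have hq0 : 0 ≤ √(2 : ℝ) := Real.sqrt_nonneg 2
  have hq1 : 11 < 8 * √(2 : ℝ) := by nlinarith
  have hq3 : √(2 : ℝ) < 3 / 2 := by nlinarith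
  have hs2 : √(8 * √(2 : ℝ) - 11) ^ 2 = 8 * √(2 : ℝ) - 11 := Real.sq_sqrt (by linarith)
  have hs0 : 0 < √(8 * √(2 : ℝ) - 11) := Real.sqrt_pos.2 (by linarith)
  set q := √(2 : ℝ)
  set s := √(8 * q - 11)
  have hs1 : s < 1 := by nlinarith
  intro x₀ c
  have hx : x₀ = (1 - s) / 2 := rfl
  have hx0 : 0 < x₀ := by rw [hx]; linarith
  have hx2 : x₀ ^ 2 = x₀ - (3 - 2 * q) := by rw [hx]; linear_combination hs2 / 4
  refine ⟨hx0, ?_, fun y hy0 hy => ?_, ?_⟩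
  · linear_combination (x₀ ^ 2 - x₀ + 3 + 2 * q) * hx2 + 4 * hq2
  · have h1 : ((2 * y - 1) ^ 2 - s ^ 2) * ((2 * y - 1) ^ 2 + 11 + 8 * q) = 0 := by
      linear_combination 16 * hy - ((2 * y - 1) ^ 2 + 11 + 8 * q) * hs2 - 64 * hq2
    have h2 : (2 * y - 1) ^ 2 = s ^ 2 := by
      rcases mul_eq_zero.1 h1 with h | h
      · linarith
      · nlinarith [sq_nonneg (2 * y - 1)]
    have := (abs_le_of_sq_le_sq' h2.le hs0.le).1
    rw [hx]
    linarith
  · refine exists_asymptotics_of_quadratic (k := 3 + 2 * q) (l := 3 - 2 * q) hx0 ?_ ?_ ?_ ?_ ?_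
      hx2 ?_
    · rw [hx]; linarith
    · linarith
    · linarith
    · ring
    · linear_combination -4 * hq2
    · rw [hx]; nlinarith
end

section
/- Let σ be a sock pattern and let p be a sock sequence that avoids the reverse of σ. Then φ_σ(p) equals the reverse of p (every sock is pushed onto the stack before any sock is popped). Consequently, if p avoids both σ and the reverse of σ, then φ_σ(φ_σ(p)) = p, so p is a periodic point of φ_σ of period dividing 2; and if such a p is not sorted, then φ_σ^k(p) is not sorted for any k ≥ 0. -/
attribute [local instance] Classical.propDecidable

theorem SameShape.reverse {A B : Type*} {q : List A} {r : List B} (h : SameShape q r) :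
    SameShape q.reverse r.reverse := by
  obtain ⟨hl, h⟩ := h
  refine ⟨by simpa using hl, fun i j => ?_⟩
  have := h (q.length - 1 - i) (q.length - 1 - j)
  rcases lt_or_ge i q.length with hi | hi <;> rcases lt_or_ge j q.length with hj | hj <;>
    grind [List.getElem?_eq_none]

theorem ContainsPat.reverse {A B : Type*} {p : List A} {σ : List B} (h : ContainsPat p σ) :
    ContainsPat p.reverse σ.reverse := by
  obtain ⟨q, hq, hs⟩ := h
  exact ⟨q.reverse, hq.reverse, hs.reverse⟩

theorem containsPat_reverse_left {A B : Type*} {p : List A} {σ : List B} :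
    ContainsPat p.reverse σ ↔ ContainsPat p σ.reverse :=
  ⟨fun h => by simpa using h.reverse, fun h => by simpa using h.reverse⟩

theorem ContainsPat.mono {A B : Type*} {p p' : List A} {σ : List B} (h : ContainsPat p σ)
    (hp : p.Sublist p') : ContainsPat p' σ := by
  obtain ⟨q, hq, hs⟩ := h
  exact ⟨q, hq.trans hp, hs⟩

theorem SortedSocks.reverse {A : Type*} {p : List A} (h : SortedSocks p) :
    SortedSocks p.reverse := by
  intro i j k hij hjk hik
  have := h (p.length - 1 - k) (p.length - 1 - j) (p.length - 1 - i) (by omega) (by omega)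
  rcases lt_or_ge k p.length with hk | hk
  · rw [List.getElem?_reverse (by omega), List.getElem?_reverse hk] at hik
    rw [List.getElem?_reverse (by omega), List.getElem?_reverse (by omega), this hik.symm, hik]
  · have hi : p.reverse.length ≤ i := by
      rwa [List.getElem?_eq_none (l := p.reverse) (i := k) (by simpa using hk),
        List.getElem?_eq_none_iff] at hik
    rw [List.getElem?_eq_none hi, List.getElem?_eq_none (hi.trans hij)]

theorem sortAux_of_not_containsPat {A B : Type*} (σ : List B) (input stack : List A)
    (h : ¬ ContainsPat (input.reverse ++ stack) σ) :
    sortAux σ input stack = input.reverse ++ stack := by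
  induction input generalizing stack with
  | nil => simp [sortAux]
  | cons x input ih =>
    have hx : ¬ ContainsPat (x :: stack) σ := fun hc => h (hc.mono (by simp))
    rw [sortAux.eq_def]
    simp [hx, ih (x :: stack) (by simpa using h)]

theorem phi_eq_reverse {A B : Type*} {σ : List B} {p : List A}
    (h : ¬ ContainsPat p σ.reverse) : phi σ p = p.reverse := by
  simpa [phi] using
    sortAux_of_not_containsPat σ p [] (by simpa [containsPat_reverse_left] using h)

/-- If a sock sequence `p` avoids the reverse of the pattern `σ`, then
`φ_σ(p)` is the reverse of `p`.  Consequently, if `p` avoids both `σ` and the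
reverse of `σ`, then `φ_σ(φ_σ(p)) = p` (so `p` is a periodic point of `φ_σ` of
period dividing 2), and if moreover `p` is not sorted, then no iterate
`φ_σ^k(p)` is sorted. -/
theorem phi_of_avoids_reverse {A B : Type*} (σ : List B) (p : List A)
    (hrev : ¬ ContainsPat p σ.reverse) :
    phi σ p = p.reverse ∧
    (¬ ContainsPat p σ →
      phi σ (phi σ p) = p ∧
      (¬ SortedSocks p → ∀ k : ℕ, ¬ SortedSocks ((phi σ)^[k] p))) := by
  have hp : phi σ p = p.reverse := phi_eq_reverse hrev
  refine ⟨hp, fun h => ?_⟩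
  have hpp : phi σ p.reverse = p := by
    rw [phi_eq_reverse (by simpa [containsPat_reverse_left] using h), List.reverse_reverse]
  refine ⟨by rw [hp, hpp], fun hs k => ?_⟩
  have hk : (phi σ)^[k] p = p ∨ (phi σ)^[k] p = p.reverse := by
    induction k with
    | zero => exact Or.inl rfl
    | succ k ih =>
      rw [Function.iterate_succ_apply']
      rcases ih with ih | ih <;> simp [ih, hp, hpp]
  rcases hk with hk | hk <;> rw [hk]
  · exact hs
  · exact fun hr => hs (by simpa using hr.reverse)
end
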